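/- arXiv:1110.3653 — 6 statements merged into one kernel-verified Lean document; each statement's English description precedes it below -/
import Mathlib

section
/- Let G be an abelian group, let B ⊆ G be a submonoid, let A ⊆ B be a submonoid, and let R be a commutative integral domain. For each coset g of the subgroup G(A) inside the subgroup G(B), let M_g denote the R-submodule of the monoid algebra R[B] spanned by the basis elements {t^b : b ∈ B, b ∈ g}. Then each M_g is an R[A]-submodule of R[B] (with R[A] acting via the algebra map induced by the inclusion A ⊆ B), and R[B] is the internal direct sum of the submodules M_g over all cosets g ∈ G(B)/G(A). -/
noncomputable section

/-- The subgroup of the ambient abelian group generated by a submonoid. -/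
abbrev grpOf {G : Type*} [AddCommGroup G] (A : AddSubmonoid G) : AddSubgroup G :=
  AddSubgroup.closure (A : Set G)

/-- The coset of `G(A)` in `G(B)` determined by an element `b ∈ B`. -/
def cosetOf {G : Type*} [AddCommGroup G] (A B : AddSubmonoid G) (b : B) :
    grpOf B ⧸ (grpOf A).addSubgroupOf (grpOf B) :=
  QuotientAddGroup.mk ⟨(b : G), AddSubgroup.subset_closure b.2⟩

/-- The `R`-submodule of `R[B]` spanned by the basis elements `t^b` with `b ∈ B` lying in the
coset `g` of `G(A)` inside `G(B)`. -/
def Mg {G : Type*} [AddCommGroup G] (R : Type*) [CommRing R] (A B : AddSubmonoid G)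
    (g : grpOf B ⧸ (grpOf A).addSubgroupOf (grpOf B)) :
    Submodule R (AddMonoidAlgebra R B) :=
  Submodule.span R {x | ∃ b : B, cosetOf A B b = g ∧ x = AddMonoidAlgebra.single b 1}

/-- The degree map `B → G(B)/G(A)`, sending an element to its coset. -/
def cosetHom {G : Type*} [AddCommGroup G] (A B : AddSubmonoid G) :
    B →+ grpOf B ⧸ (grpOf A).addSubgroupOf (grpOf B) where
  toFun := cosetOf A B
  map_zero' := rfl
  map_add' _ _ := rfl

theorem cosetHom_inclusion {G : Type*} [AddCommGroup G] {A B : AddSubmonoid G} (hAB : A ≤ B)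
    (a : A) : cosetHom A B (AddSubmonoid.inclusion hAB a) = 0 :=
  (QuotientAddGroup.eq_zero_iff _).2 <|
    AddSubgroup.mem_addSubgroupOf.2 <| AddSubgroup.subset_closure a.2

theorem Mg_eq_gradeBy {G : Type*} [AddCommGroup G] (R : Type*) [CommRing R]
    (A B : AddSubmonoid G) (g : grpOf B ⧸ (grpOf A).addSubgroupOf (grpOf B)) :
    Mg R A B g = AddMonoidAlgebra.gradeBy R (cosetHom A B) g := by
  apply le_antisymm
  · refine Submodule.span_le.2 ?_
    rintro _ ⟨b, rfl, rfl⟩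
    exact AddMonoidAlgebra.single_mem_gradeBy (cosetHom A B) b 1
  · intro x hx
    rw [← AddMonoidAlgebra.sum_coeff_single x]
    refine Submodule.sum_mem _ fun b hb => ?_
    have hb' : AddMonoidAlgebra.single b (1 : R) ∈ Mg R A B g :=
      Submodule.subset_span ⟨b, hx b hb, rfl⟩
    simpa using Submodule.smul_mem _ (x.coeff b) hb'

theorem mapDomainRingHom_inclusion_mem_gradeBy_zero {G : Type*} [AddCommGroup G] {R : Type*}
    [CommRing R] {A B : AddSubmonoid G} (hAB : A ≤ B) (p : AddMonoidAlgebra R A) :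
    AddMonoidAlgebra.mapDomainRingHom R (AddSubmonoid.inclusion hAB) p ∈
      AddMonoidAlgebra.gradeBy R (cosetHom A B) 0 := by
  rw [← AddMonoidAlgebra.sum_coeff_single p, Finsupp.sum, map_sum]
  refine Submodule.sum_mem _ fun a _ => ?_
  rw [← cosetHom_inclusion hAB a]
  simpa using AddMonoidAlgebra.single_mem_gradeBy (cosetHom A B)
    (AddSubmonoid.inclusion hAB a) (p.coeff a)

/-- Each `M_g` is an `R[A]`-submodule of `R[B]` (the `R[A]`-action being
multiplication by the image under the map `R[A] → R[B]` induced by the inclusion `A ⊆ B`),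
and `R[B]` is the internal direct sum of the `M_g` over all cosets `g ∈ G(B)/G(A)`. -/
theorem semigroup_algebra_decomposition
    {G : Type*} [AddCommGroup G] (R : Type*) [CommRing R] [IsDomain R]
    (A B : AddSubmonoid G) (hAB : A ≤ B)
    [DecidableEq (grpOf B ⧸ (grpOf A).addSubgroupOf (grpOf B))] :
    (∀ (g : grpOf B ⧸ (grpOf A).addSubgroupOf (grpOf B))
        (p : AddMonoidAlgebra R A) (x : AddMonoidAlgebra R B),
        x ∈ Mg R A B g →
          (AddMonoidAlgebra.mapDomainRingHom R (AddSubmonoid.inclusion hAB)) p * x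
            ∈ Mg R A B g) ∧
    DirectSum.IsInternal (fun g : grpOf B ⧸ (grpOf A).addSubgroupOf (grpOf B) =>
      Mg R A B g) := by
  simp only [Mg_eq_gradeBy]
  refine ⟨fun g p x hx => ?_, AddMonoidAlgebra.gradeBy.isInternal (cosetHom A B)⟩
  simpa using SetLike.mul_mem_graded (mapDomainRingHom_inclusion_mem_gradeBy_zero hAB p) hx
end
end

section
/- Let G be an abelian group, let B ⊆ G be a submonoid, let A ⊆ B be a submonoid, and let R be a commutative integral domain. For each coset g of G(A) in G(B), let M_g denote the R-submodule of R[B] spanned by {t^b : b ∈ B, b ∈ g}. Then for every h ∈ g, one has b − h ∈ G(A) for all b ∈ B ∩ g, and M_g is isomorphic, as an R[A]-module, to the R[A]-submodule of the group algebra R[G(A)] spanned by {t^{b−h} : b ∈ B ∩ g}. -/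
noncomputable section

/-- The inclusion of a submonoid into the subgroup it generates. -/
def inclGrp {G : Type*} [AddCommGroup G] (A : AddSubmonoid G) : A →+ grpOf A where
  toFun a := ⟨(a : G), AddSubgroup.subset_closure a.2⟩
  map_zero' := rfl
  map_add' _ _ := rfl

open AddMonoidAlgebra in
/-- The linear map of monoid algebras sending `t^m` to `t^n` if `f m = some n` and to `0` if
`f m = none`. -/
def partialMapDomain (R : Type*) [CommRing R] {M N : Type*} (f : M → Option N) :
    AddMonoidAlgebra R M →ₗ[R] AddMonoidAlgebra R N :=
  Finsupp.linearCombination R (fun m ↦ (f m).elim 0 (single · 1)) ∘ₗ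
    (coeffLinearEquiv R).toLinearMap

lemma partialMapDomain_single (R : Type*) [CommRing R] {M N : Type*} (f : M → Option N)
    (m : M) (r : R) :
    partialMapDomain R f (AddMonoidAlgebra.single m r) =
      (f m).elim 0 (AddMonoidAlgebra.single · r) := by
  cases hf : f m <;> simp [partialMapDomain, hf]

section Translation

variable {G : Type*} [AddCommGroup G] (A B : AddSubmonoid G)

lemma cosetOf_eq_mk_iff (h : grpOf B) (b : B) :
    cosetOf A B b = QuotientAddGroup.mk h ↔ (b : G) - (h : G) ∈ grpOf A := by
  rw [cosetOf, eq_comm, QuotientAddGroup.eq, AddSubgroup.mem_addSubgroupOf]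
  simp [neg_add_eq_sub]

open Classical in
/-- The partial translation `b ↦ b - h` from `B` to `G(A)`. -/
def subTranslate (h : G) (b : B) : Option (grpOf A) :=
  if hb : (b : G) - h ∈ grpOf A then some ⟨b - h, hb⟩ else none

open Classical in
/-- The partial translation `c ↦ c + h` from `G(A)` to `B`. -/
def addTranslate (h : G) (c : grpOf A) : Option B :=
  if hc : (c : G) + h ∈ B then some ⟨c + h, hc⟩ else none

variable {A B}

lemma subTranslate_of_mem {h : G} {b : B} (hb : (b : G) - h ∈ grpOf A) :
    subTranslate A B h b = some ⟨b - h, hb⟩ := dif_pos hb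

lemma addTranslate_sub {h : G} {b : B} (hb : (b : G) - h ∈ grpOf A) :
    addTranslate A B h ⟨b - h, hb⟩ = some b := by
  simp [addTranslate]

lemma subTranslate_inclusion_add (hAB : A ≤ B) (h : G) (a : A) (b : B) :
    subTranslate A B h (AddSubmonoid.inclusion hAB a + b) =
      (subTranslate A B h b).map (inclGrp A a + ·) := by
  have ha : (a : G) ∈ grpOf A := AddSubgroup.subset_closure a.2
  have key : (a : G) + b - h ∈ grpOf A ↔ (b : G) - h ∈ grpOf A := by
    rw [add_sub_assoc, AddSubgroup.add_mem_cancel_left _ ha]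
  by_cases hb : (b : G) - h ∈ grpOf A
  · rw [subTranslate_of_mem hb, subTranslate_of_mem (by simpa using key.2 hb)]
    simp [inclGrp, add_sub_assoc]
  · simp [subTranslate, key, hb]

lemma partialMapDomain_subTranslate_mul (R : Type*) [CommRing R] (hAB : A ≤ B) (h : G)
    (p : AddMonoidAlgebra R A) (x : AddMonoidAlgebra R B) :
    partialMapDomain R (subTranslate A B h)
        (AddMonoidAlgebra.mapDomainRingHom R (AddSubmonoid.inclusion hAB) p * x) =
      AddMonoidAlgebra.mapDomainRingHom R (inclGrp A) p *
        partialMapDomain R (subTranslate A B h) x := by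
  induction p using AddMonoidAlgebra.induction_linear with
  | zero => simp
  | add p q hp hq => simp only [map_add, add_mul, hp, hq]
  | single a r =>
    induction x using AddMonoidAlgebra.induction_linear with
    | zero => simp
    | add x y hx hy => simp only [map_add, mul_add, hx, hy]
    | single b s =>
      simp only [AddMonoidAlgebra.mapDomainRingHom_apply,
        AddMonoidAlgebra.mapDomain_single, AddMonoidAlgebra.single_mul_single,
        partialMapDomain_single, subTranslate_inclusion_add]
      cases subTranslate A B h b <;> simp [AddMonoidAlgebra.single_mul_single]

end Translation

/-- For a coset `g` of `G(A)` in `G(B)` with representative `h ∈ g`, every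
`b ∈ B ∩ g` satisfies `b - h ∈ G(A)`, and `M_g` is isomorphic as an `R[A]`-module to the
`R[A]`-submodule of `R[G(A)]` spanned by the `t^{b-h}` for `b ∈ B ∩ g`. -/
theorem semigroup_algebra_summand_iso
    {G : Type*} [AddCommGroup G] (R : Type*) [CommRing R] [IsDomain R]
    (A B : AddSubmonoid G) (hAB : A ≤ B)
    (g : grpOf B ⧸ (grpOf A).addSubgroupOf (grpOf B))
    (h : grpOf B) (hh : QuotientAddGroup.mk h = g) :
    (∀ b : B, cosetOf A B b = g → (b : G) - (h : G) ∈ grpOf A) ∧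
    ∃ e : Mg R A B g ≃ₗ[R]
        Submodule.span R {x : AddMonoidAlgebra R (grpOf A) |
          ∃ (b : B) (hb : (b : G) - (h : G) ∈ grpOf A),
            cosetOf A B b = g ∧ x = AddMonoidAlgebra.single ⟨(b : G) - (h : G), hb⟩ 1},
      ∀ (p : AddMonoidAlgebra R A) (x : AddMonoidAlgebra R B) (hx : x ∈ Mg R A B g)
        (hpx : (AddMonoidAlgebra.mapDomainRingHom R (AddSubmonoid.inclusion hAB)) p * x
          ∈ Mg R A B g),
        (e ⟨(AddMonoidAlgebra.mapDomainRingHom R (AddSubmonoid.inclusion hAB)) p * x, hpx⟩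
            : AddMonoidAlgebra R (grpOf A)) =
          (AddMonoidAlgebra.mapDomainRingHom R (inclGrp A)) p *
            (e ⟨x, hx⟩ : AddMonoidAlgebra R (grpOf A)) := by
  subst hh
  refine ⟨fun b ↦ (cosetOf_eq_mk_iff A B h b).1, ?_⟩
  let φ := partialMapDomain R (subTranslate A B (h : G))
  let ψ := partialMapDomain R (addTranslate A B (h : G))
  have hφ {b : B} (hb : (b : G) - h ∈ grpOf A) :
      φ (AddMonoidAlgebra.single b 1) = AddMonoidAlgebra.single ⟨b - h, hb⟩ 1 := by
    simp [φ, partialMapDomain_single, subTranslate_of_mem hb]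
  have hψ {b : B} (hb : (b : G) - h ∈ grpOf A) :
      ψ (AddMonoidAlgebra.single ⟨b - h, hb⟩ 1) = AddMonoidAlgebra.single b 1 := by
    simp [ψ, partialMapDomain_single, addTranslate_sub hb]
  refine ⟨LinearEquiv.ofLinearMap (φ.restrict fun x hx ↦ ?_) (ψ.restrict fun x hx ↦ ?_) ?_ ?_,
    fun p x _ _ ↦ partialMapDomain_subTranslate_mul R hAB h p x⟩
  · refine Submodule.mem_comap.1 (Submodule.span_le.2 ?_ hx)
    rintro _ ⟨b, hb, rfl⟩
    have hb' := (cosetOf_eq_mk_iff A B h b).1 hb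
    exact Submodule.subset_span ⟨b, hb', hb, hφ hb'⟩
  · refine Submodule.mem_comap.1 (Submodule.span_le.2 ?_ hx)
    rintro _ ⟨b, hb', hb, rfl⟩
    exact Submodule.subset_span ⟨b, hb, hψ hb'⟩
  · ext1 ⟨x, hx⟩
    refine Subtype.ext (LinearMap.eqOn_span (f := φ ∘ₗ ψ) (g := .id) ?_ hx)
    rintro _ ⟨b, hb', hb, rfl⟩
    simp only [LinearMap.comp_apply, LinearMap.id_apply, hψ hb', hφ hb']
  · ext1 ⟨x, hx⟩
    refine Subtype.ext (LinearMap.eqOn_span (f := ψ ∘ₗ φ) (g := .id) ?_ hx)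
    rintro _ ⟨b, hb, rfl⟩
    have hb' := (cosetOf_eq_mk_iff A B h b).1 hb
    simp only [LinearMap.comp_apply, LinearMap.id_apply, hψ hb', hφ hb']
end
end

section
/- Let A ⊆ B be submonoids of ℕ^m and set B_A := {x ∈ B : x ∉ B + (A ∖ {0})}. Then B = B_A + A (that is, every b ∈ B can be written as b = x + a with x ∈ B_A and a ∈ A), and B_A is the unique minimal such set: for every subset S ⊆ B with S + A = B one has B_A ⊆ S. -/
open Pointwise

noncomputable section

/-- Coordinatewise cast `ℕ^m → ℚ^m`. -/
def natCastQ {m : ℕ} (x : Fin m → ℕ) : Fin m → ℚ := fun i => (x i : ℚ)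

/-- Coordinatewise cast `ℕ^m → ℤ^m`. -/
def natCastZ {m : ℕ} (x : Fin m → ℕ) : Fin m → ℤ := fun i => (x i : ℤ)

/-- Coordinatewise cast `ℤ^m → ℚ^m`. -/
def intCastQ {m : ℕ} (x : Fin m → ℤ) : Fin m → ℚ := fun i => (x i : ℚ)

/-- The rational convex cone spanned by a subset of `ℕ^m` inside `ℚ^m`. -/
def ratCone {m : ℕ} (X : Set (Fin m → ℕ)) : Set (Fin m → ℚ) :=
  {y | ∃ (k : ℕ) (q : Fin k → ℚ) (x : Fin k → (Fin m → ℕ)),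
    (∀ i, 0 ≤ q i) ∧ (∀ i, x i ∈ X) ∧ y = ∑ i, q i • natCastQ (x i)}

/-- `B_A = {x ∈ B : x ∉ B + (A ∖ {0})}`. -/
def BA {m : ℕ} (A B : AddSubmonoid (Fin m → ℕ)) : Set (Fin m → ℕ) :=
  {x | x ∈ B ∧ x ∉ (B : Set (Fin m → ℕ)) + ((A : Set (Fin m → ℕ)) \ {0})}

/-- The subgroup of `ℤ^m` generated by a subset of `ℕ^m`. -/
def grpZ {m : ℕ} (X : Set (Fin m → ℕ)) : AddSubgroup (Fin m → ℤ) :=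
  AddSubgroup.closure (natCastZ '' X)

/-- Every element of `B` lies in `B_A + A`, by well-founded induction on the product order. -/
theorem mem_BA_add_of_mem {m : ℕ} (A B : AddSubmonoid (Fin m → ℕ)) (b : Fin m → ℕ)
    (hb : b ∈ B) : b ∈ BA A B + (A : Set (Fin m → ℕ)) := by
  induction b using WellFoundedLT.induction with
  | ind b ih =>
    by_cases h : b ∈ (B : Set (Fin m → ℕ)) + ((A : Set (Fin m → ℕ)) \ {0})
    · obtain ⟨c, hc, a, ⟨ha, ha0⟩, rfl⟩ := h
      have hlt : c < c + a := lt_add_of_pos_right c (pos_iff_ne_zero.mpr ha0)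
      obtain ⟨x, hx, a', ha', rfl⟩ := ih c hlt hc
      exact ⟨x, hx, a' + a, A.add_mem ha' ha, (add_assoc x a' a).symm⟩
    · exact ⟨b, ⟨hb, h⟩, 0, A.zero_mem, add_zero b⟩

/-- `B = B_A + A`, and `B_A` is the unique minimal subset of `B` with this
property. -/
theorem BA_add_eq_and_minimal {m : ℕ} (A B : AddSubmonoid (Fin m → ℕ)) (hAB : A ≤ B) :
    (B : Set (Fin m → ℕ)) = BA A B + (A : Set (Fin m → ℕ)) ∧
    ∀ S : Set (Fin m → ℕ), S ⊆ (B : Set (Fin m → ℕ)) →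
      S + (A : Set (Fin m → ℕ)) = (B : Set (Fin m → ℕ)) → BA A B ⊆ S := by
  refine ⟨Set.Subset.antisymm (fun b hb => mem_BA_add_of_mem A B b hb) ?_, ?_⟩
  · rintro _ ⟨x, hx, a, ha, rfl⟩
    exact B.add_mem hx.1 (hAB ha)
  · rintro S hSB hSA x ⟨hxB, hx⟩
    rw [← SetLike.mem_coe, ← hSA] at hxB
    obtain ⟨s, hs, a, ha, rfl⟩ := hxB
    rcases eq_or_ne a 0 with rfl | ha0
    · simpa using hs
    · exact (hx ⟨s, hSB hs, a, ⟨ha, ha0⟩, rfl⟩).elim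
end
end

section
/- Let A ⊆ B ⊆ ℕ^m be positive affine semigroups. Then the set B_A := {x ∈ B : x ∉ B + (A ∖ {0})} is finite if and only if C(A) = C(B), where C(X) denotes the convex cone spanned by X over the nonnegative rationals in ℚ^m. -/
open Pointwise

noncomputable section

lemma natCastQ_injective {m : ℕ} : Function.Injective (natCastQ (m := m)) := fun x y h =>
  funext fun i => by simpa [natCastQ] using congrFun h i

lemma natCastQ_nsmul {m : ℕ} (n : ℕ) (x : Fin m → ℕ) :
    natCastQ (n • x) = (n : ℚ) • natCastQ x := by
  ext i; simp [natCastQ]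

lemma natCastQ_sum {m : ℕ} {ι : Type*} (s : Finset ι) (f : ι → Fin m → ℕ) :
    natCastQ (∑ i ∈ s, f i) = ∑ i ∈ s, natCastQ (f i) := by
  ext i; simp [natCastQ, Finset.sum_apply]

/-- Finitely many nonnegative rationals have a common denominator. -/
lemma exists_pos_mul_eq_natCast {ι : Type*} [Fintype ι] (q : ι → ℚ) (hq : ∀ i, 0 ≤ q i) :
    ∃ N : ℕ, 0 < N ∧ ∃ c : ι → ℕ, ∀ i, (N : ℚ) * q i = c i := by
  refine ⟨∏ i, (q i).den, Finset.prod_pos fun i _ => (q i).den_pos, ?_⟩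
  have h : ∀ i, ∃ c : ℕ, ((∏ i, (q i).den : ℕ) : ℚ) * q i = c := by
    intro i
    obtain ⟨d, hd⟩ := Finset.dvd_prod_of_mem (fun i => (q i).den) (Finset.mem_univ i)
    obtain ⟨k, hk⟩ := Int.eq_ofNat_of_zero_le (Rat.num_nonneg.2 (hq i))
    refine ⟨d * k, ?_⟩
    have h1 : ((q i).den : ℚ) * q i = k := by
      rw [mul_comm, Rat.mul_den_eq_num, hk]; simp
    rw [hd]
    push_cast
    rw [← h1]
    ring
  choose c hc using h
  exact ⟨c, hc⟩

lemma exists_pos_nsmul_mem_of_mem_ratCone {m : ℕ} {A : AddSubmonoid (Fin m → ℕ)}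
    {b : Fin m → ℕ} (hb : natCastQ b ∈ ratCone (A : Set (Fin m → ℕ))) :
    ∃ N : ℕ, 0 < N ∧ N • b ∈ A := by
  obtain ⟨k, q, x, hq, hx, hy⟩ := hb
  obtain ⟨N, hN, c, hc⟩ := exists_pos_mul_eq_natCast q hq
  refine ⟨N, hN, ?_⟩
  have h : N • b = ∑ i, c i • x i := by
    apply natCastQ_injective
    simp only [natCastQ_nsmul, natCastQ_sum, hy, Finset.smul_sum, smul_smul, hc]
  rw [h]
  exact sum_mem fun i _ => nsmul_mem (hx i) _

lemma natCastQ_mem_ratCone {m : ℕ} {X : Set (Fin m → ℕ)} {x : Fin m → ℕ} (hx : x ∈ X) :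
    natCastQ x ∈ ratCone X :=
  ⟨1, fun _ => 1, fun _ => x, by simp, by simpa using hx, by simp⟩

lemma ratCone_mono {m : ℕ} {X Y : Set (Fin m → ℕ)} (h : X ⊆ Y) : ratCone X ⊆ ratCone Y := by
  rintro y ⟨k, q, x, hq, hx, hy⟩
  exact ⟨k, q, x, hq, fun i => h (hx i), hy⟩

lemma ratCone_subset_of_forall_exists_nsmul_mem {m : ℕ} {X Y : Set (Fin m → ℕ)}
    (h : ∀ b ∈ Y, ∃ N : ℕ, 0 < N ∧ N • b ∈ X) : ratCone Y ⊆ ratCone X := by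
  rintro y ⟨k, q, x, hq, hx, rfl⟩
  choose N hN hNX using fun i => h (x i) (hx i)
  refine ⟨k, fun i => q i / N i, fun i => N i • x i,
    fun i => div_nonneg (hq i) (Nat.cast_nonneg _), hNX, ?_⟩
  refine Finset.sum_congr rfl fun i _ => ?_
  have : (N i : ℚ) ≠ 0 := by exact_mod_cast (hN i).ne'
  rw [natCastQ_nsmul, smul_smul, div_mul_cancel₀ _ this]

/-- The cones of `A ≤ B` agree iff every element of `B` has a positive multiple in `A`. -/
lemma ratCone_eq_iff_forall_exists_nsmul_mem {m : ℕ} {A B : AddSubmonoid (Fin m → ℕ)}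
    (hAB : A ≤ B) :
    ratCone (A : Set (Fin m → ℕ)) = ratCone (B : Set (Fin m → ℕ)) ↔
      ∀ b ∈ B, ∃ N : ℕ, 0 < N ∧ N • b ∈ A := by
  constructor
  · intro h b hb
    exact exists_pos_nsmul_mem_of_mem_ratCone (h ▸ natCastQ_mem_ratCone hb)
  · intro h
    exact (ratCone_mono hAB).antisymm (ratCone_subset_of_forall_exists_nsmul_mem h)

/-- Every element of `B` is the sum of an element of `B_A` and an element of `A`. -/
lemma exists_mem_BA_add_mem {m : ℕ} {A B : AddSubmonoid (Fin m → ℕ)} {x : Fin m → ℕ}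
    (hx : x ∈ B) : ∃ r ∈ BA A B, ∃ a ∈ A, r + a = x := by
  induction x using WellFoundedLT.induction with
  | _ x ih =>
    by_cases h : x ∈ BA A B
    · exact ⟨x, h, 0, zero_mem _, add_zero _⟩
    · have h' : x ∈ (B : Set (Fin m → ℕ)) + ((A : Set (Fin m → ℕ)) \ {0}) := by
        by_contra h'
        exact h ⟨hx, h'⟩
      obtain ⟨b, hb, a, ⟨ha, ha0⟩, rfl⟩ := h'
      have hlt : b < b + a := lt_add_of_pos_right b (pos_iff_ne_zero.2 ha0)
      obtain ⟨r, hr, a', ha', rfl⟩ := ih b hlt hb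
      exact ⟨r, hr, a' + a, add_mem ha' ha, (add_assoc _ _ _).symm⟩

lemma exists_pos_nsmul_mem_of_finite_BA {m : ℕ} {A B : AddSubmonoid (Fin m → ℕ)}
    (hA : A.FG) (hfin : (BA A B).Finite) {b : Fin m → ℕ} (hb : b ∈ B) :
    ∃ N : ℕ, 0 < N ∧ N • b ∈ A := by
  obtain ⟨S, rfl⟩ := hA
  have h : ∀ n : ℕ, ∃ (r : BA (AddSubmonoid.closure (S : Set (Fin m → ℕ))) B) (c : S → ℕ),
      (r : Fin m → ℕ) + ∑ i, c i • (i : Fin m → ℕ) = n • b := by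
    intro n
    obtain ⟨r, hr, a, ha, hra⟩ := exists_mem_BA_add_mem
      (A := AddSubmonoid.closure (S : Set (Fin m → ℕ))) (nsmul_mem hb n)
    obtain ⟨f, -, rfl⟩ := AddSubmonoid.mem_closure_finset.1 ha
    refine ⟨⟨r, hr⟩, fun i => f i, ?_⟩
    rw [← hra, Finset.sum_coe_sort S fun i => f i • i]
  choose r c hrc using h
  have := hfin.to_subtype
  have hwqo := (Finite.wellQuasiOrdered (α := BA (AddSubmonoid.closure (S : Set (Fin m → ℕ))) B)
    (· = ·)).prod (wellQuasiOrdered_le (α := S → ℕ))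
  obtain ⟨i, j, hij, hr, hc⟩ := hwqo fun n => (r n, c n)
  refine ⟨j - i, Nat.sub_pos_of_lt hij, ?_⟩
  have key : (j - i) • b = ∑ s, (c j s - c i s) • (s : Fin m → ℕ) := by
    have h1 : i • b + (j - i) • b = i • b + ∑ s, (c j s - c i s) • (s : Fin m → ℕ) := by
      rw [← add_nsmul, Nat.add_sub_cancel' hij.le, ← hrc i, ← hrc j, add_assoc,
        ← Finset.sum_add_distrib]
      simp only at hr
      rw [hr]
      congr 1
      refine Finset.sum_congr rfl fun s _ => ?_
      rw [← add_nsmul, Nat.add_sub_cancel' (hc s)]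
    exact add_left_cancel h1
  rw [key]
  exact sum_mem fun s _ => nsmul_mem (AddSubmonoid.subset_closure s.2) _

lemma finite_BA_of_forall_exists_nsmul_mem {m : ℕ} {A B : AddSubmonoid (Fin m → ℕ)}
    (hB : B.FG) (h : ∀ b ∈ B, ∃ N : ℕ, 0 < N ∧ N • b ∈ A) : (BA A B).Finite := by
  classical
  obtain ⟨S, rfl⟩ := hB
  choose! N hN hNA using h
  have hfin : (Set.univ.pi fun s : (S.erase 0 : Finset (Fin m → ℕ)) =>
      Set.Iio (N (s : Fin m → ℕ))).Finite := Set.Finite.pi fun _ => Set.finite_Iio _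
  refine (hfin.image fun c => ∑ s : (S.erase 0 : Finset (Fin m → ℕ)), c s • (s : Fin m → ℕ)).subset ?_
  rintro x ⟨hx, hx'⟩
  obtain ⟨f, -, rfl⟩ := AddSubmonoid.mem_closure_finset.1 hx
  refine ⟨fun s => f s, fun s _ => ?_, ?_⟩
  · obtain ⟨s, hs⟩ := s
    obtain ⟨hs0, hsS⟩ := Finset.mem_erase.1 hs
    have hsB : s ∈ AddSubmonoid.closure (S : Set (Fin m → ℕ)) := AddSubmonoid.subset_closure hsS
    by_contra hlt
    have hle : N s ≤ f s := not_lt.1 hlt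
    refine hx' ⟨(f s - N s) • s + ∑ t ∈ S.erase s, f t • t, ?_, N s • s, ⟨hNA s hsB, ?_⟩, ?_⟩
    · exact add_mem (nsmul_mem hsB _) (sum_mem fun t ht =>
        nsmul_mem (AddSubmonoid.subset_closure (Finset.mem_of_mem_erase ht)) _)
    · exact smul_ne_zero (hN s hsB).ne' hs0
    · dsimp only
      rw [add_right_comm, ← add_nsmul, Nat.sub_add_cancel hle,
        Finset.add_sum_erase S (fun t => f t • t) hsS]
  · dsimp only
    rw [Finset.sum_coe_sort (S.erase 0) fun s => f s • s]
    exact Finset.sum_erase S (smul_zero _)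

/-- For positive affine semigroups `A ⊆ B ⊆ ℕ^m`, the set `B_A` is finite if
and only if `C(A) = C(B)`. -/
theorem BA_finite_iff_cone_eq {m : ℕ} (A B : AddSubmonoid (Fin m → ℕ)) (hAB : A ≤ B)
    (hA : A.FG) (hB : B.FG) :
    (BA A B).Finite ↔ ratCone (A : Set (Fin m → ℕ)) = ratCone (B : Set (Fin m → ℕ)) := by
  rw [ratCone_eq_iff_forall_exists_nsmul_mem hAB]
  exact ⟨fun h _ hb => exists_pos_nsmul_mem_of_finite_BA hA h hb,
    finite_BA_of_forall_exists_nsmul_mem hB⟩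
end
end

section
/- Let B ⊆ ℕ^m be a positive affine semigroup, let e₁, …, e_d ∈ B be linearly independent over ℚ with C({e₁,…,e_d}) = C(B), let A be the submonoid of B generated by e₁,…,e_d, let K be a field, and set B_A := {x ∈ B : x ∉ B + (A ∖ {0})}. Then K[B] is a free module over K[A] if and only if distinct elements of B_A lie in distinct cosets of G(A) in G(B), i.e., for all x, y ∈ B_A, x − y ∈ G(A) implies x = y. (Equivalently, since K[A] is a polynomial ring in d variables, K[B] is Cohen–Macaulay if and only if every summand I_g in the decomposition of K[B] equals K[A].) -/
open Pointwise

noncomputable section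

section MonoidAlgebra

open AddMonoidAlgebra

variable {M N : Type*} [AddCommMonoid M] [AddCommMonoid N] (K : Type*) [Field K]

/-- If every element of `N` is uniquely of the form `s + f a` with `s ∈ S` and `a : M`, then
`K[N]` is free over `K[M]`. -/
theorem free_of_bijective_add (f : M →+ N) (S : Set N)
    (h : Function.Bijective fun p : S × M => (p.1 : N) + f p.2) :
    letI := (mapDomainRingHom K f).toModule
    Module.Free (AddMonoidAlgebra K M) (AddMonoidAlgebra K N) := by
  let := (mapDomainRingHom K f).toModule
  obtain ⟨E, hE⟩ : ∃ E : (S →₀ AddMonoidAlgebra K M) ≃+ AddMonoidAlgebra K N,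
      ∀ (s : S) (a : M) (r : K),
        E (Finsupp.single s (single a r)) = single ((s : N) + f a) r := by
    refine ⟨(Finsupp.mapRange.addEquiv coeffAddEquiv).trans
      ((Finsupp.curryAddEquiv (α := S) (β := M) (M := K)).symm.trans
        ((Finsupp.domCongr (Equiv.ofBijective _ h)).trans coeffAddEquiv.symm)), fun s a r => ?_⟩
    ext
    simp [Finsupp.curryAddEquiv]
  have hlin (c : AddMonoidAlgebra K M) (x : S →₀ AddMonoidAlgebra K M) :
      E (c • x) = mapDomainRingHom K f c * E x := by
    induction x using Finsupp.induction_linear with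
    | zero => simp
    | add x y hx hy => rw [smul_add, map_add, map_add, hx, hy, mul_add]
    | single s u =>
      rw [Finsupp.smul_single, smul_eq_mul]
      induction u using AddMonoidAlgebra.induction_linear with
      | zero => simp
      | add u v hu hv => rw [mul_add, Finsupp.single_add, map_add, hu, hv, Finsupp.single_add,
          map_add, mul_add]
      | single b t =>
        induction c using AddMonoidAlgebra.induction_linear with
        | zero => simp
        | add c d hc hd => rw [add_mul, Finsupp.single_add, map_add, hc, hd, map_add, add_mul]
        | single a r =>
          rw [single_mul_single, hE, hE]
          simp [add_left_comm]
  let L : (S →₀ AddMonoidAlgebra K M) ≃ₗ[AddMonoidAlgebra K M] AddMonoidAlgebra K N :=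
    E.toLinearEquiv hlin
  exact Module.Free.of_basis (Module.Basis.ofRepr L.symm)

/-- Suppose the monomial `t ^ a` divides every monomial `t ^ s` of `K[M]` with
`t ^ a ∣ t ^ a' * t ^ s`. If `K[N]` is free over `K[M]`, the same holds for monomials of `K[N]`. -/
theorem exists_eq_add_of_free [IsCancelAdd M] (f : M →+ N)
    (h : letI := (mapDomainRingHom K f).toModule
      Module.Free (AddMonoidAlgebra K M) (AddMonoidAlgebra K N))
    {a a' : M} (hcop : ∀ s r, a' + s = a + r → ∃ t, s = a + t)
    {x y : N} (hxy : f a + x = f a' + y) : ∃ z, y = f a + z := by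
  let := (mapDomainRingHom K f).toModule
  let b := Module.Free.chooseBasis (AddMonoidAlgebra K M) (AddMonoidAlgebra K N)
  have hsmul (c : M) (w : AddMonoidAlgebra K N) :
      (single c 1 : AddMonoidAlgebra K M) • w = single (f c) 1 * w := by
    change mapDomainRingHom K f (single c 1) * w = _
    simp
  have hrel : (single a 1 : AddMonoidAlgebra K M) • (single x 1 : AddMonoidAlgebra K N) =
      (single a' 1 : AddMonoidAlgebra K M) • (single y 1 : AddMonoidAlgebra K N) := by
    simp [hsmul, hxy]
  have hdvd (i) : ∃ u, b.repr (single y 1) i = single a 1 * u := by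
    have hi : single a 1 * b.repr (single x 1) i = single a' 1 * b.repr (single y 1) i := by
      simpa using congrArg (fun w => b.repr w i) hrel
    have hmem : b.repr (single y 1) i ∈ Ideal.span (of' K M '' {a}) := by
      rw [mem_ideal_span_of'_image]
      intro s hs
      by_contra! hne
      have hc := congrArg (fun w => w.coeff (a' + s)) hi
      rw [coeff_single_mul_add, one_mul, coeff_single_mul_of_forall_add_ne] at hc
      · exact Finsupp.mem_support_iff.mp hs hc.symm
      · intro r hr
        obtain ⟨t, rfl⟩ := hcop s r hr.symm
        exact hne a rfl t (add_comm a t)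
    rw [Set.image_singleton, Ideal.mem_span_singleton] at hmem
    exact hmem
  choose u hu using hdvd
  have hy : (single y 1 : AddMonoidAlgebra K N) =
      single (f a) 1 * ∑ i ∈ (b.repr (single y 1)).support, u i • b i := by
    rw [← hsmul, Finset.smul_sum]
    conv_lhs => rw [← b.linearCombination_repr (single y 1), Finsupp.linearCombination_apply,
      Finsupp.sum]
    refine Finset.sum_congr rfl fun i _ => ?_
    rw [hu, mul_smul]
  by_contra! hne
  have := congrArg (fun w => w.coeff y) hy
  simp [coeff_single_mul_of_forall_add_ne _ _ fun d hd => hne d hd.symm] at this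

end MonoidAlgebra

section Semigroup

variable {m d : ℕ}

theorem natCastZ_injective : Function.Injective (natCastZ : (Fin m → ℕ) → Fin m → ℤ) :=
  fun x y h => funext fun i => by simpa [natCastZ] using congrFun h i

theorem natCastZ_add (x y : Fin m → ℕ) : natCastZ (x + y) = natCastZ x + natCastZ y := by
  ext i
  simp [natCastZ]

theorem linearCombination_injective_of_natCastQ {e : Fin d → Fin m → ℕ}
    (hind : LinearIndependent ℚ fun i => natCastQ (e i)) :
    Function.Injective (Fintype.linearCombination ℕ e) := by
  have hcast (n : Fin d → ℕ) : natCastQ (Fintype.linearCombination ℕ e n) =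
      Fintype.linearCombination ℚ (fun i => natCastQ (e i)) (natCastQ n) := by
    ext j
    simp [natCastQ, Fintype.linearCombination_apply]
  intro p q hpq
  have h := hind.fintypeLinearCombination_injective
    ((hcast p).symm.trans ((congrArg natCastQ hpq).trans (hcast q)))
  exact funext fun i => by simpa [natCastQ] using congrFun h i

theorem mem_closure_range_iff_linearCombination {e : Fin d → Fin m → ℕ} {a : Fin m → ℕ} :
    a ∈ AddSubmonoid.closure (Set.range e) ↔ ∃ n, Fintype.linearCombination ℕ e n = a := by
  simp only [AddSubmonoid.mem_closure_range_iff_of_fintype, Fintype.linearCombination_apply, eq_comm]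

/-- Elements in the same coset of the group generated by `A` become equal after translating them
by suitable elements of `A`. -/
theorem exists_add_eq_add_of_sub_mem_grpZ {A : AddSubmonoid (Fin m → ℕ)} {x y : Fin m → ℕ}
    (h : natCastZ x - natCastZ y ∈ grpZ (A : Set (Fin m → ℕ))) :
    ∃ a ∈ A, ∃ a' ∈ A, a + x = a' + y := by
  have key (g) (hg : g ∈ grpZ (A : Set (Fin m → ℕ))) :
      ∃ a ∈ A, ∃ a' ∈ A, g = natCastZ a' - natCastZ a := by
    induction hg using AddSubgroup.closure_induction with
    | mem g hg =>
      obtain ⟨a, ha, rfl⟩ := hg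
      exact ⟨0, A.zero_mem, a, ha, by ext; simp [natCastZ]⟩
    | zero => exact ⟨0, A.zero_mem, 0, A.zero_mem, by simp⟩
    | add g k _ _ hg hk =>
      obtain ⟨a, ha, a', ha', rfl⟩ := hg
      obtain ⟨c, hc, c', hc', rfl⟩ := hk
      refine ⟨a + c, A.add_mem ha hc, a' + c', A.add_mem ha' hc', ?_⟩
      rw [natCastZ_add, natCastZ_add]
      abel
    | neg g _ hg =>
      obtain ⟨a, ha, a', ha', rfl⟩ := hg
      exact ⟨a', ha', a, ha, by abel⟩
  obtain ⟨a, ha, a', ha', h⟩ := key _ h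
  refine ⟨a, ha, a', ha', natCastZ_injective ?_⟩
  rw [natCastZ_add, natCastZ_add, add_comm, add_comm (natCastZ a')]
  rw [sub_eq_sub_iff_add_eq_add] at h
  rw [h, add_comm]

theorem sub_mem_grpZ_of_add_eq_add {A : AddSubmonoid (Fin m → ℕ)} {x y a a' : Fin m → ℕ}
    (ha : a ∈ A) (ha' : a' ∈ A) (h : x + a = y + a') :
    natCastZ x - natCastZ y ∈ grpZ (A : Set (Fin m → ℕ)) := by
  have h' : natCastZ x - natCastZ y = natCastZ a' - natCastZ a := by
    rw [sub_eq_sub_iff_add_eq_add, ← natCastZ_add, h, natCastZ_add, add_comm]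
  rw [h']
  exact sub_mem (AddSubgroup.subset_closure ⟨a', ha', rfl⟩)
    (AddSubgroup.subset_closure ⟨a, ha, rfl⟩)

theorem eq_zero_of_add_mem_BA {A B : AddSubmonoid (Fin m → ℕ)} {a b : Fin m → ℕ} (ha : a ∈ A)
    (hb : b ∈ B) (h : a + b ∈ BA A B) : a = 0 := by
  by_contra h0
  exact h.2 ⟨b, hb, a, ⟨ha, h0⟩, add_comm b a⟩

theorem exists_mem_BA_add {A B : AddSubmonoid (Fin m → ℕ)} (b : Fin m → ℕ) (hb : b ∈ B) :
    ∃ x ∈ BA A B, ∃ a ∈ A, x + a = b := by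
  induction hn : ∑ i, b i using Nat.strong_induction_on generalizing b with
  | _ n ih =>
    by_cases hbA : b ∈ BA A B
    · exact ⟨b, hbA, 0, A.zero_mem, add_zero b⟩
    · obtain ⟨c, hc, a, ⟨ha, ha0⟩, rfl⟩ : b ∈ (B : Set (Fin m → ℕ)) + ((A : Set _) \ {0}) := by
        by_contra h
        exact hbA ⟨hb, h⟩
      have hpos : 0 < ∑ i, a i := by
        rw [Nat.pos_iff_ne_zero]
        intro h
        exact ha0 (funext fun i => Finset.sum_eq_zero_iff.mp h i (Finset.mem_univ i))
      have hlt : ∑ i, c i < n := by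
        simp only [Pi.add_apply, Finset.sum_add_distrib] at hn
        omega
      obtain ⟨x, hx, a', ha', rfl⟩ := ih _ hlt c hc rfl
      exact ⟨x, hx, a' + a, A.add_mem ha' ha, (add_assoc _ _ _).symm⟩

/-- Any two elements of a free submonoid have the same difference as two elements without common
generators; for the latter, `a ≤ a' + s` in the divisibility order implies `a ≤ s`. -/
theorem exists_coprime_add_eq_add {e : Fin d → Fin m → ℕ}
    (hind : LinearIndependent ℚ fun i => natCastQ (e i)) {A : AddSubmonoid (Fin m → ℕ)}
    (hA : A = AddSubmonoid.closure (Set.range e)) {x y a a' : Fin m → ℕ} (ha : a ∈ A)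
    (ha' : a' ∈ A) (h : a + x = a' + y) :
    ∃ c c' : A, (∀ s r, c' + s = c + r → ∃ t, s = c + t) ∧ (c : Fin m → ℕ) + x = c' + y := by
  subst hA
  obtain ⟨n, rfl⟩ := mem_closure_range_iff_linearCombination.mp ha
  obtain ⟨n', rfl⟩ := mem_closure_range_iff_linearCombination.mp ha'
  refine ⟨⟨_, mem_closure_range_iff_linearCombination.mpr ⟨n - n', rfl⟩⟩,
    ⟨_, mem_closure_range_iff_linearCombination.mpr ⟨n' - n, rfl⟩⟩, ?_, ?_⟩
  · rintro ⟨s, hs⟩ ⟨r, hr⟩ hsr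
    obtain ⟨p, rfl⟩ := mem_closure_range_iff_linearCombination.mp hs
    obtain ⟨q, rfl⟩ := mem_closure_range_iff_linearCombination.mp hr
    have hpq : n' - n + p = n - n' + q := by
      apply linearCombination_injective_of_natCastQ hind
      rw [map_add, map_add]
      exact congrArg Subtype.val hsr
    refine ⟨⟨_, mem_closure_range_iff_linearCombination.mpr ⟨p - (n - n'), rfl⟩⟩,
      Subtype.ext ?_⟩
    change _ = Fintype.linearCombination ℕ e _ + Fintype.linearCombination ℕ e _
    rw [← map_add]
    refine congrArg (Fintype.linearCombination ℕ e) (funext fun i => ?_)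
    have := congrFun hpq i
    simp only [Pi.add_apply, Pi.sub_apply] at this ⊢
    omega
  · have h1 : n = n - n' + n ⊓ n' := by
      ext i
      simp only [Pi.add_apply, Pi.sub_apply, Pi.inf_apply]
      omega
    have h2 : n' = n' - n + n ⊓ n' := by
      ext i
      simp only [Pi.add_apply, Pi.sub_apply, Pi.inf_apply]
      omega
    rw [congrArg (Fintype.linearCombination ℕ e) h1, congrArg (Fintype.linearCombination ℕ e) h2,
      map_add, map_add, add_right_comm, add_right_comm _ _ y] at h
    simpa using add_right_cancel h

end Semigroup

/-- For a simplicial semigroup `B` with `A` generated by linearly independent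
elements `e₁,…,e_d` of `B` spanning the same cone, `K[B]` is a free `K[A]`-module if and only
if distinct elements of `B_A` lie in distinct cosets of `G(A)` in `G(B)`. -/
theorem free_iff_BA_injects_into_cosets {m d : ℕ} (K : Type*) [Field K]
    (B : AddSubmonoid (Fin m → ℕ)) (hB : B.FG)
    (e : Fin d → (Fin m → ℕ)) (he : ∀ i, e i ∈ B)
    (hind : LinearIndependent ℚ (fun i => natCastQ (e i)))
    (hcone : ratCone (Set.range e) = ratCone (B : Set (Fin m → ℕ)))
    (A : AddSubmonoid (Fin m → ℕ)) (hA : A = AddSubmonoid.closure (Set.range e))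
    (hAB : A ≤ B) :
    (letI := (AddMonoidAlgebra.mapDomainRingHom K (AddSubmonoid.inclusion hAB)).toModule
     Module.Free (AddMonoidAlgebra K A) (AddMonoidAlgebra K B)) ↔
    ∀ x ∈ BA A B, ∀ y ∈ BA A B,
      natCastZ x - natCastZ y ∈ grpZ (A : Set (Fin m → ℕ)) → x = y := by
  constructor
  · intro hfree x hx y hy hxy
    obtain ⟨a, ha, a', ha', h⟩ := exists_add_eq_add_of_sub_mem_grpZ hxy
    obtain ⟨c, c', hcop, hc⟩ := exists_coprime_add_eq_add hind hA ha ha' h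
    obtain ⟨z, hz⟩ := exists_eq_add_of_free K (AddSubmonoid.inclusion hAB) hfree hcop
      (x := ⟨x, hx.1⟩) (y := ⟨y, hy.1⟩) (Subtype.ext hc)
    have hz' : y = c + z := congrArg Subtype.val hz
    have hc0 : (c : Fin m → ℕ) = 0 := eq_zero_of_add_mem_BA c.2 z.2 (hz' ▸ hy)
    rw [hc0, zero_add] at hc
    have hc'0 : (c' : Fin m → ℕ) = 0 := eq_zero_of_add_mem_BA c'.2 hy.1 (hc ▸ hx)
    rwa [hc'0, zero_add] at hc
  · intro h
    refine free_of_bijective_add K (AddSubmonoid.inclusion hAB)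
      {b | (b : Fin m → ℕ) ∈ BA A B} ⟨?_, ?_⟩
    · rintro ⟨⟨x, hx⟩, a⟩ ⟨⟨y, hy⟩, a'⟩ hxy
      have hxy' : (x : Fin m → ℕ) + a = y + a' := congrArg Subtype.val hxy
      have hxy_eq : (x : Fin m → ℕ) = y :=
        h _ hx _ hy (sub_mem_grpZ_of_add_eq_add a.2 a'.2 hxy')
      obtain rfl : x = y := Subtype.ext hxy_eq
      obtain rfl : a = a' := Subtype.ext (add_left_cancel hxy')
      rfl
    · rintro ⟨b, hb⟩
      obtain ⟨x, hx, a, ha, rfl⟩ := exists_mem_BA_add (A := A) b hb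
      exact ⟨⟨⟨⟨x, hx.1⟩, hx⟩, ⟨a, ha⟩⟩, rfl⟩
end
end

section
/- Let B ⊆ ℕ^m be a positive affine semigroup, let e₁, …, e_d ∈ B be linearly independent over ℚ with C({e₁,…,e_d}) = C(B), and let A be the submonoid of B generated by e₁,…,e_d. Suppose e_k = e_k' + e_k'' for some k ∈ {1,…,d} with e_k', e_k'' ∈ B ∖ {0}, and let A' be the submonoid of B generated by e₁, …, e_{k−1}, e_k', e_{k+1}, …, e_d. For a submonoid X of B generated by elements f₁,…,f_d, set B_X := {x ∈ B : x ∉ B + (X ∖ {0})} and D̄_X := {x ∈ B : x = λ₁f₁ + ⋯ + λ_d f_d with λ_i ∈ ℚ, 0 ≤ λ_i ≤ 1 for all i}. Then B_A ⊆ D̄_A if and only if B_{A'} ⊆ D̄_{A'}. -/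
open Pointwise

noncomputable section

/-- `D̄_X = {x ∈ B : x = Σ λᵢ fᵢ, λᵢ ∈ ℚ, 0 ≤ λᵢ ≤ 1}` for generators `f₁,…,f_d`. -/
def DbarSet {m d : ℕ} (B : AddSubmonoid (Fin m → ℕ)) (f : Fin d → (Fin m → ℕ)) :
    Set (Fin m → ℕ) :=
  {x | x ∈ B ∧ ∃ lam : Fin d → ℚ,
    (∀ i, 0 ≤ lam i ∧ lam i ≤ 1) ∧ natCastQ x = ∑ i, lam i • natCastQ (f i)}

lemma natCastQ_add {m : ℕ} (x y : Fin m → ℕ) :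
    natCastQ (x + y) = natCastQ x + natCastQ y := by
  ext i; simp [natCastQ]

lemma eq_zero_or_exists_eq_add_of_mem_closure {M ι : Type*} [AddCommMonoid M] {f : ι → M} {a : M}
    (ha : a ∈ AddSubmonoid.closure (Set.range f)) :
    a = 0 ∨ ∃ j, ∃ b ∈ AddSubmonoid.closure (Set.range f), a = b + f j := by
  induction ha using AddSubmonoid.closure_induction with
  | mem x hx =>
    obtain ⟨j, rfl⟩ := hx
    exact Or.inr ⟨j, 0, zero_mem _, (zero_add _).symm⟩
  | zero => exact Or.inl rfl
  | add x y hx hy ihx ihy =>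
    rcases ihy with rfl | ⟨j, b, hb, rfl⟩
    · simpa using ihx
    · exact Or.inr ⟨j, x + b, add_mem hx hb, (add_assoc _ _ _).symm⟩

/-- `x` lies outside `B_A` exactly when some generator of `A` can be subtracted from `x` in `B`. -/
lemma mem_BA_closure_range_iff {m d : ℕ} {B : AddSubmonoid (Fin m → ℕ)}
    {f : Fin d → (Fin m → ℕ)} (hf : ∀ i, f i ∈ B) (hf0 : ∀ i, f i ≠ 0) {x : Fin m → ℕ} :
    x ∈ BA (AddSubmonoid.closure (Set.range f)) B ↔
      x ∈ B ∧ ¬ ∃ j, ∃ y ∈ B, x = y + f j := by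
  refine and_congr_right fun _ => not_congr ⟨?_, ?_⟩
  · rintro ⟨b, hb, a, ⟨ha, ha0⟩, rfl⟩
    rcases eq_zero_or_exists_eq_add_of_mem_closure ha with rfl | ⟨j, c, hc, rfl⟩
    · exact absurd rfl ha0
    · have hcB : c ∈ B := AddSubmonoid.closure_le.2 (Set.range_subset_iff.2 hf) hc
      exact ⟨j, b + c, add_mem hb hcB, (add_assoc _ _ _).symm⟩
  · rintro ⟨j, y, hy, rfl⟩
    exact ⟨y, hy, f j, ⟨AddSubmonoid.subset_closure ⟨j, rfl⟩, hf0 j⟩, rfl⟩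

/-- `B_A ⊆ D̄_A` holds if and only if every generator whose coordinate in `x ∈ B` exceeds `1`
can be subtracted from `x` inside `B`. -/
lemma BA_subset_DbarSet_iff {m d : ℕ} {B : AddSubmonoid (Fin m → ℕ)}
    {f : Fin d → (Fin m → ℕ)} (hf : ∀ i, f i ∈ B)
    (φ : Fin d → (Fin m → ℚ) →ₗ[ℚ] ℚ)
    (hφ : ∀ (lam : Fin d → ℚ) i, φ i (∑ j, lam j • natCastQ (f j)) = lam i)
    (hrep : ∀ x ∈ B, ∃ lam : Fin d → ℚ,
      (∀ i, 0 ≤ lam i) ∧ natCastQ x = ∑ i, lam i • natCastQ (f i)) :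
    BA (AddSubmonoid.closure (Set.range f)) B ⊆ DbarSet B f ↔
      ∀ i, ∀ x ∈ B, 1 < φ i (natCastQ x) → ∃ y ∈ B, x = y + f i := by
  have hδ : ∀ i j, φ i (natCastQ (f j)) = if i = j then 1 else 0 := by
    intro i j
    have := hφ (Pi.single j 1) i
    simpa [Pi.single_apply, ite_smul] using this
  have hf0 : ∀ i, f i ≠ 0 := by
    intro i h
    have h0 : natCastQ (0 : Fin m → ℕ) = 0 := by ext; simp [natCastQ]
    have := hδ i i
    simp [h, h0] at this
  constructor
  · intro h i x
    induction hn : ∑ l, x l using Nat.strong_induction_on generalizing x with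
    | _ n ih =>
      intro hx hgt
      have hxA : x ∉ BA (AddSubmonoid.closure (Set.range f)) B := by
        intro hxA
        obtain ⟨-, lam, hlam, hxl⟩ := h hxA
        rw [hxl, hφ] at hgt
        exact absurd (hlam i).2 (not_le.2 hgt)
      obtain ⟨j, y, hy, rfl⟩ : ∃ j, ∃ y ∈ B, x = y + f j := by
        by_contra hcon
        exact hxA ((mem_BA_closure_range_iff hf hf0).2 ⟨hx, hcon⟩)
      by_cases hij : i = j
      · exact ⟨y, hy, by rw [hij]⟩
      · obtain ⟨l, hl⟩ := Function.ne_iff.1 (hf0 j)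
        have hlt : ∑ l, y l < n := by
          rw [← hn]
          refine Finset.sum_lt_sum (fun _ _ => by simp) ⟨l, Finset.mem_univ _, ?_⟩
          simpa [Nat.pos_iff_ne_zero] using hl
        obtain ⟨z, hz, rfl⟩ := ih _ hlt y rfl hy (by
          simpa [natCastQ_add, hδ, hij] using hgt)
        exact ⟨z + f j, add_mem hz (hf j), add_right_comm _ _ _⟩
  · intro h x hx
    obtain ⟨hxB, hx'⟩ := (mem_BA_closure_range_iff hf hf0).1 hx
    obtain ⟨lam, hlam, hxl⟩ := hrep x hxB
    refine ⟨hxB, lam, fun i => ⟨hlam i, ?_⟩, hxl⟩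
    by_contra hgt
    refine hx' ⟨i, h i x hxB ?_⟩
    rw [hxl, hφ]
    exact lt_of_not_ge hgt

/-- Linearly independent vectors admit coordinate functionals on the whole space. -/
lemma LinearIndependent.exists_coordinates {K V ι : Type*} [Field K] [AddCommGroup V] [Module K V]
    [Fintype ι] {v : ι → V} (hv : LinearIndependent K v) :
    ∃ φ : ι → V →ₗ[K] K, ∀ (c : ι → K) i, φ i (∑ j, c j • v j) = c i := by
  obtain ⟨g, hg⟩ := LinearMap.exists_leftInverse_of_injective (Fintype.linearCombination K v)
    (LinearMap.ker_eq_bot.2 hv.fintypeLinearCombination_injective)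
  refine ⟨fun i => (LinearMap.proj i).comp g, fun c i => ?_⟩
  have := congrFun (LinearMap.congr_fun hg c) i
  simpa [Fintype.linearCombination_apply] using this

/-- Elements of `ratCone (Set.range e)` are nonnegative combinations indexed by `e` itself. -/
lemma exists_nonneg_of_mem_ratCone_range {m d : ℕ} {e : Fin d → (Fin m → ℕ)} {y : Fin m → ℚ}
    (hy : y ∈ ratCone (Set.range e)) :
    ∃ lam : Fin d → ℚ, (∀ i, 0 ≤ lam i) ∧ y = ∑ i, lam i • natCastQ (e i) := by
  obtain ⟨n, q, x, hq, hx, rfl⟩ := hy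
  choose s hs using hx
  refine ⟨fun i => ∑ j with s j = i, q j, fun i => Finset.sum_nonneg fun j _ => hq j, ?_⟩
  simp_rw [Finset.sum_smul, ← hs]
  rw [← Finset.sum_fiberwise Finset.univ s]
  refine Finset.sum_congr rfl fun i _ => Finset.sum_congr rfl fun j hj => ?_
  rw [(Finset.mem_filter.1 hj).2]

/-- If every `x ∈ B` with `c < φ x` stays in `B` after subtracting `u`, where `φ u = c > 0`,
then one may subtract `u` repeatedly. -/
lemma exists_eq_add_nsmul {m : ℕ} {B : AddSubmonoid (Fin m → ℕ)} (φ : (Fin m → ℚ) →ₗ[ℚ] ℚ)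
    {u : Fin m → ℕ} {c : ℚ} (hc : 0 < c) (hu : φ (natCastQ u) = c)
    (h : ∀ x ∈ B, c < φ (natCastQ x) → ∃ y ∈ B, x = y + u) (n : ℕ) :
    ∀ x ∈ B, n * c < φ (natCastQ x) → ∃ y ∈ B, x = y + n • u := by
  induction n with
  | zero => exact fun x hx _ => ⟨x, hx, by simp⟩
  | succ n ih =>
    intro x hx hlt
    push_cast at hlt
    obtain ⟨y, hy, rfl⟩ := ih x hx (by linarith)
    rw [natCastQ_add, natCastQ_nsmul, map_add, map_smul, hu, smul_eq_mul] at hlt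
    obtain ⟨z, hz, rfl⟩ := h y hy (by linarith)
    exact ⟨z, hz, by rw [succ_nsmul, add_assoc, add_comm u]⟩

/-- Splitting `v = u + w` along a ray: subtractability of `v` past coordinate `1` is equivalent to
subtractability of `u` past its own coordinate `c`. -/
lemma forall_sub_iff_of_eq_add {m : ℕ} {B : AddSubmonoid (Fin m → ℕ)} (φ : (Fin m → ℚ) →ₗ[ℚ] ℚ)
    {u v w : Fin m → ℕ} {c : ℚ} (hw : w ∈ B) (hv : v = u + w)
    (hφ : φ (natCastQ v) = 1) (hc : 0 < c) (hc1 : c ≤ 1) (hu : natCastQ u = c • natCastQ v) :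
    (∀ x ∈ B, 1 < φ (natCastQ x) → ∃ y ∈ B, x = y + v) ↔
      ∀ x ∈ B, c < φ (natCastQ x) → ∃ y ∈ B, x = y + u := by
  have hφu : φ (natCastQ u) = c := by rw [hu, map_smul, hφ, smul_eq_mul, mul_one]
  have hw' : natCastQ w = (1 - c) • natCastQ v := by
    rw [sub_smul, one_smul, ← hu, eq_sub_iff_add_eq', ← natCastQ_add, ← hv]
  have hφw : φ (natCastQ w) = 1 - c := by rw [hw', map_smul, hφ, smul_eq_mul, mul_one]
  constructor
  · intro h x hx hlt
    obtain ⟨y, hy, hxy⟩ := h (x + w) (add_mem hx hw) (by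
      rw [natCastQ_add, map_add, hφw]; linarith)
    refine ⟨y, hy, add_right_cancel (b := w) ?_⟩
    rw [hxy, hv, add_assoc]
  · intro h x hx hlt
    obtain ⟨p, q, hpq⟩ : ∃ p q : ℕ, ((q + 1 : ℕ) : ℚ) * (1 - c) = p * c := by
      have hr : 0 ≤ (1 - c) / c := div_nonneg (by linarith) hc.le
      refine ⟨((1 - c) / c).num.toNat, ((1 - c) / c).den - 1, ?_⟩
      rw [Nat.sub_add_cancel ((1 - c) / c).den_pos]
      have h1 : ((((1 - c) / c).num.toNat : ℕ) : ℚ) = (((1 - c) / c).num : ℚ) := by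
        exact_mod_cast congrArg (Int.cast : ℤ → ℚ) (Int.toNat_of_nonneg (Rat.num_nonneg.2 hr))
      rw [h1, ← Rat.den_mul_eq_num, mul_assoc, div_mul_cancel₀ _ hc.ne']
    have hwu : (q + 1) • w = p • u := by
      apply natCastQ_injective
      rw [natCastQ_nsmul, natCastQ_nsmul, hw', hu, smul_smul, smul_smul, hpq]
    obtain ⟨y, hy, hxy⟩ := exists_eq_add_nsmul φ hc hφu h (p + 1) (x + q • w)
      (add_mem hx (nsmul_mem hw q)) (by
        rw [natCastQ_add, natCastQ_nsmul, map_add, map_smul, hφw, smul_eq_mul]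
        push_cast at hpq ⊢
        linarith)
    refine ⟨y, hy, add_right_cancel (b := q • w) ?_⟩
    rw [hxy, succ_nsmul, ← hwu, hv, succ_nsmul]
    abel

/-- If `e_k = e_k' + e_k''` with `e_k', e_k'' ∈ B ∖ {0}`, and `A'` is
generated by `e₁,…,e_k',…,e_d`, then `B_A ⊆ D̄_A` if and only if `B_{A'} ⊆ D̄_{A'}`. -/
theorem seminormality_transfer {m d : ℕ}
    (B : AddSubmonoid (Fin m → ℕ)) (hB : B.FG)
    (e : Fin d → (Fin m → ℕ)) (he : ∀ i, e i ∈ B)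
    (hind : LinearIndependent ℚ (fun i => natCastQ (e i)))
    (hcone : ratCone (Set.range e) = ratCone (B : Set (Fin m → ℕ)))
    (k : Fin d) (ek' ek'' : Fin m → ℕ)
    (hk1 : ek' ∈ B) (hk2 : ek'' ∈ B) (hk1' : ek' ≠ 0) (hk2' : ek'' ≠ 0)
    (hk : e k = ek' + ek'') :
    (BA (AddSubmonoid.closure (Set.range e)) B ⊆ DbarSet B e ↔
     BA (AddSubmonoid.closure (Set.range (Function.update e k ek'))) B ⊆
       DbarSet B (Function.update e k ek')) := by
  classical
  obtain ⟨φ, hφ⟩ := hind.exists_coordinates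
  have hrep : ∀ x ∈ B, ∃ lam : Fin d → ℚ,
      (∀ i, 0 ≤ lam i) ∧ natCastQ x = ∑ i, lam i • natCastQ (e i) := fun x hx =>
    exists_nonneg_of_mem_ratCone_range
      (hcone ▸ ⟨1, fun _ => 1, fun _ => x, fun _ => zero_le_one, fun _ => hx, by simp⟩)
  have hδ : ∀ i j, φ i (natCastQ (e j)) = if i = j then 1 else 0 := by
    intro i j
    have := hφ (Pi.single j 1) i
    simpa [Pi.single_apply, ite_smul] using this
  obtain ⟨c, hc, hc1, hu⟩ : ∃ c : ℚ, 0 < c ∧ c ≤ 1 ∧ natCastQ ek' = c • natCastQ (e k) := by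
    obtain ⟨a, ha, hea⟩ := hrep ek' hk1
    obtain ⟨b, hb, heb⟩ := hrep ek'' hk2
    have hab : ∀ i, a i + b i = if i = k then 1 else 0 := fun i => by
      rw [← hδ i k, hk, natCastQ_add, map_add, hea, heb, hφ, hφ]
    have hek : natCastQ ek' = a k • natCastQ (e k) := by
      rw [hea]
      refine Finset.sum_eq_single k (fun i _ hik => ?_) (by simp)
      have h0 := hab i
      rw [if_neg hik] at h0
      rw [show a i = 0 by linarith [ha i, hb i], zero_smul]
    refine ⟨a k, (ha k).lt_of_ne fun h => hk1' (natCastQ_injective ?_), ?_, hek⟩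
    · rw [hek, ← h, zero_smul]
      ext
      simp [natCastQ]
    · have h1 := hab k
      rw [if_pos rfl] at h1
      linarith [hb k]
  set f := Function.update e k ek' with hf
  set w : Fin d → ℚ := fun i => if i = k then c else 1 with hw
  have hw0 : ∀ i, 0 < w i := fun i => by
    by_cases h : i = k <;> simp [hw, h, hc]
  have hfw : ∀ i, natCastQ (f i) = w i • natCastQ (e i) := fun i => by
    by_cases h : i = k
    · subst h
      simp [hf, hw, hu]
    · simp [hf, hw, h]
  have hfB : ∀ i, f i ∈ B := fun i => by
    by_cases h : i = k
    · subst h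
      simpa [hf] using hk1
    · simpa [hf, h] using he i
  rw [BA_subset_DbarSet_iff he φ hφ hrep,
    BA_subset_DbarSet_iff hfB (fun i => (w i)⁻¹ • φ i)
      (fun lam i => by
        simp only [hfw, smul_smul, LinearMap.smul_apply]
        rw [hφ fun j => lam j * w j, smul_eq_mul, mul_comm, mul_inv_cancel_right₀ (hw0 i).ne'])
      (fun x hx => by
        obtain ⟨lam, hlam, hxl⟩ := hrep x hx
        refine ⟨fun i => lam i * (w i)⁻¹, fun i => mul_nonneg (hlam i) (inv_nonneg.2 (hw0 i).le), ?_⟩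
        simp only [hfw, smul_smul, inv_mul_cancel_right₀ (hw0 _).ne', hxl])]
  refine forall_congr' fun i => ?_
  by_cases h : i = k
  · subst h
    rw [forall_sub_iff_of_eq_add (φ i) hk2 hk (by simp [hδ]) hc hc1 hu]
    simp [hf, hw, lt_inv_mul_iff₀ hc]
  · simp [hf, hw, h]
end
end
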